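/- Let R be an integral domain and Ê a w-universal injective R-module. For every R-module M, the natural evaluation map φ_M : M → Hom_R(Hom_R(M, Ê), Ê), m ↦ (g ↦ g(m)), is a w-pure w-monomorphism: its kernel is GV-torsion, and for every R-module L the kernel of id_L ⊗ φ_M : L ⊗_R M → L ⊗_R Hom_R(Hom_R(M, Ê), Ê) is GV-torsion. -/

import Mathlib

open TensorProduct

/-- A finitely generated ideal `J` is a GV-ideal if the natural map
`R → Hom_R(J, R)`, sending `r` to multiplication by `r`, is bijective. -/
def IsGVIdeal {R : Type*} [CommRing R] (J : Ideal R) : Prop :=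
  J.FG ∧ Function.Bijective fun r : R => (r • J.subtype : J →ₗ[R] R)

/-- An element `m` of an `R`-module is a GV-torsion element if it is
annihilated by some GV-ideal. -/
def IsGVTorsionElem (R : Type*) [CommRing R] {M : Type*} [AddCommGroup M] [Module R M]
    (m : M) : Prop :=
  ∃ J : Ideal R, IsGVIdeal J ∧ ∀ j ∈ J, j • m = 0

/-- An `R`-module `E` is `w`-universal injective if `E` is injective, GV-torsion-free,
and for every GV-torsion-free module `A` and nonzero `x ∈ A` there is `f : A → E`
with `f x ≠ 0`. -/
def IsWUniversalInjective (R : Type u) [CommRing R] (E : Type u) [AddCommGroup E]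
    [Module R E] : Prop :=
  Module.Injective R E ∧ (∀ e : E, IsGVTorsionElem R e → e = 0) ∧
  ∀ (A : Type u) [AddCommGroup A] [Module R A],
    (∀ a : A, IsGVTorsionElem R a → a = 0) →
    ∀ x : A, x ≠ 0 → ∃ f : A →ₗ[R] E, f x ≠ 0

/-- The natural evaluation map `M → Hom_R(Hom_R(M, E), E)`, `m ↦ (g ↦ g m)`. -/
def evalMap (R : Type u) [CommRing R] (M E : Type u) [AddCommGroup M] [Module R M]
    [AddCommGroup E] [Module R E] :
    M →ₗ[R] ((M →ₗ[R] E) →ₗ[R] E) :=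
  (LinearMap.id : (M →ₗ[R] E) →ₗ[R] (M →ₗ[R] E)).flip

theorem isGVIdeal_top {R : Type*} [CommRing R] : IsGVIdeal (⊤ : Ideal R) := by
  refine ⟨⟨{1}, by simp⟩, fun r s h => ?_, fun f => ⟨f ⟨1, trivial⟩, ?_⟩⟩
  · simpa using LinearMap.congr_fun h ⟨1, trivial⟩
  · ext ⟨x, hx⟩
    have h := f.map_smul x ⟨1, trivial⟩
    have e : x • (⟨1, trivial⟩ : (⊤ : Ideal R)) = ⟨x, hx⟩ := Subtype.ext (by simp)
    rw [e] at h
    simp [h, mul_comm]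

theorem IsGVIdeal.eq_of_forall_mul_eq {R : Type*} [CommRing R] {J : Ideal R}
    (hJ : IsGVIdeal J) {r s : R} (h : ∀ j ∈ J, r * j = s * j) : r = s :=
  hJ.2.1 (LinearMap.ext fun j => h j j.2)

theorem IsGVIdeal.exists_eq_mul {R : Type*} [CommRing R] {J : Ideal R}
    (hJ : IsGVIdeal J) (f : J →ₗ[R] R) : ∃ r : R, ∀ j : J, f j = r * j := by
  obtain ⟨r, hr⟩ := hJ.2.2 f
  exact ⟨r, fun j => (LinearMap.congr_fun hr j).symm⟩

theorem IsGVIdeal.mul {R : Type*} [CommRing R] {J K : Ideal R}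
    (hJ : IsGVIdeal J) (hK : IsGVIdeal K) : IsGVIdeal (J * K) := by
  refine ⟨hJ.1.mul hK.1, fun r s h => ?_, fun f => ?_⟩
  · refine hJ.eq_of_forall_mul_eq fun j hj => hK.eq_of_forall_mul_eq fun k hk => ?_
    simpa [mul_assoc] using LinearMap.congr_fun h ⟨j * k, Ideal.mul_mem_mul hj hk⟩
  · have hf (j : J) : ∃ r : R, ∀ k : K, f ⟨j * k, Ideal.mul_mem_mul j.2 k.2⟩ = r * k :=
      hK.exists_eq_mul (f.comp (((LinearMap.mulLeft R (j : R)).comp K.subtype).codRestrict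
        (J * K) fun k => Ideal.mul_mem_mul j.2 k.2))
    choose g hg using hf
    let G : J →ₗ[R] R :=
      { toFun := g
        map_add' := fun a b => hK.eq_of_forall_mul_eq fun k hk => by
          rw [add_mul, ← hg a ⟨k, hk⟩, ← hg b ⟨k, hk⟩, ← hg (a + b) ⟨k, hk⟩, ← map_add]
          exact congrArg f (Subtype.ext (add_mul _ _ _))
        map_smul' := fun a b => hK.eq_of_forall_mul_eq fun k hk => by
          rw [RingHom.id_apply, smul_eq_mul, mul_assoc, ← hg b ⟨k, hk⟩,
            ← hg (a • b) ⟨k, hk⟩]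
          exact (congrArg f (Subtype.ext (mul_assoc a b k))).trans (map_smul f a _) }
    obtain ⟨r, hr⟩ := hJ.exists_eq_mul G
    refine ⟨r, LinearMap.ext ?_⟩
    rintro ⟨x, hx⟩
    change r * x = f ⟨x, hx⟩
    induction hx using Submodule.mul_induction_on' with
    | mem_mul_mem j hj k hk =>
      rw [hg ⟨j, hj⟩ ⟨k, hk⟩, show g ⟨j, hj⟩ = r * j from hr ⟨j, hj⟩, mul_assoc]
    | add x hx y hy ihx ihy =>
      rw [mul_add, ihx, ihy, ← map_add]
      rfl

theorem exists_isGVIdeal_forall_smul_eq_zero {R M : Type*} [CommRing R] [AddCommGroup M]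
    [Module R M] (s : Finset M) (hs : ∀ m ∈ s, IsGVTorsionElem R m) :
    ∃ J : Ideal R, IsGVIdeal J ∧ ∀ m ∈ s, ∀ j ∈ J, j • m = 0 := by
  classical
  induction s using Finset.induction_on with
  | empty => exact ⟨⊤, isGVIdeal_top, by simp⟩
  | insert a s _ ih =>
    obtain ⟨J, hJ, hJa⟩ := hs a (Finset.mem_insert_self a s)
    obtain ⟨K, hK, hKs⟩ := ih fun m hm => hs m (Finset.mem_insert_of_mem hm)
    refine ⟨J * K, hJ.mul hK, fun m hm j hj => ?_⟩
    rcases Finset.mem_insert.mp hm with rfl | hm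
    · exact hJa j (Ideal.mul_le_left hj)
    · exact hKs m hm j (Ideal.mul_le_right hj)

/-- The submodule of GV-torsion elements. -/
def gvTorsion (R M : Type*) [CommRing R] [AddCommGroup M] [Module R M] : Submodule R M where
  carrier := {m | IsGVTorsionElem R m}
  zero_mem' := ⟨⊤, isGVIdeal_top, by simp⟩
  add_mem' := by
    rintro a b ⟨J, hJ, ha⟩ ⟨K, hK, hb⟩
    refine ⟨J * K, hJ.mul hK, fun j hj => ?_⟩
    rw [smul_add, ha j (Ideal.mul_le_left hj), hb j (Ideal.mul_le_right hj), add_zero]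
  smul_mem' := by
    rintro r a ⟨J, hJ, ha⟩
    exact ⟨J, hJ, fun j hj => by rw [smul_comm, ha j hj, smul_zero]⟩

theorem isGVTorsionElem_of_forall_smul {R M : Type*} [CommRing R] [AddCommGroup M]
    [Module R M] {J : Ideal R} (hJ : IsGVIdeal J) {m : M}
    (h : ∀ j ∈ J, IsGVTorsionElem R (j • m)) : IsGVTorsionElem R m := by
  classical
  obtain ⟨S, hS⟩ := hJ.1
  obtain ⟨K, hK, hKS⟩ := exists_isGVIdeal_forall_smul_eq_zero (S.image (· • m)) fun x hx => by
    obtain ⟨s, hs, rfl⟩ := Finset.mem_image.mp hx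
    exact h s (hS ▸ Submodule.subset_span hs)
  have hKJ : ∀ k ∈ K, ∀ j ∈ J, k • j • m = 0 := by
    intro k hk j hj
    rw [← hS] at hj
    induction hj using Submodule.span_induction with
    | mem s hs => exact hKS _ (Finset.mem_image_of_mem _ hs) k hk
    | zero => simp
    | add x y _ _ hx hy => rw [add_smul, smul_add, hx, hy, add_zero]
    | smul r x _ hx => rw [smul_assoc, smul_comm, hx, smul_zero]
  refine ⟨K * J, hK.mul hJ, fun x hx => ?_⟩
  induction hx using Submodule.mul_induction_on' with
  | mem_mul_mem k hk j hj => rw [mul_smul, hKJ k hk j hj]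
  | add x _ y _ hx hy => rw [add_smul, hx, hy, add_zero]

theorem eq_zero_of_isGVTorsionElem_quotient {R M : Type*} [CommRing R] [AddCommGroup M]
    [Module R M] (a : M ⧸ gvTorsion R M) (ha : IsGVTorsionElem R a) : a = 0 := by
  obtain ⟨m, rfl⟩ := Submodule.mkQ_surjective _ a
  obtain ⟨J, hJ, h⟩ := ha
  refine (Submodule.Quotient.mk_eq_zero _).mpr (isGVTorsionElem_of_forall_smul hJ fun j hj => ?_)
  exact (Submodule.Quotient.mk_eq_zero (gvTorsion R M)).mp (h j hj)

theorem IsWUniversalInjective.exists_apply_ne_zero {R : Type u} [CommRing R] {E : Type u}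
    [AddCommGroup E] [Module R E] (hE : IsWUniversalInjective R E) {N : Type u}
    [AddCommGroup N] [Module R N] {x : N} (hx : ¬ IsGVTorsionElem R x) :
    ∃ f : N →ₗ[R] E, f x ≠ 0 := by
  obtain ⟨f, hf⟩ := hE.2.2 (N ⧸ gvTorsion R N) eq_zero_of_isGVTorsionElem_quotient
    ((gvTorsion R N).mkQ x) fun h => hx ((Submodule.Quotient.mk_eq_zero _).mp h)
  exact ⟨f.comp (gvTorsion R N).mkQ, hf⟩

/-- for a `w`-universal injective module `Ehat`, the evaluation map
`φ_M : M → Hom_R(Hom_R(M, Ehat), Ehat)` is a `w`-pure `w`-monomorphism. -/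
theorem evalMap_wpure_wmono
    {R : Type u} [CommRing R] [IsDomain R]
    (Ehat : Type u) [AddCommGroup Ehat] [Module R Ehat]
    (hE : IsWUniversalInjective R Ehat)
    (M : Type u) [AddCommGroup M] [Module R M] :
    (∀ x ∈ LinearMap.ker (evalMap R M Ehat), IsGVTorsionElem R x) ∧
    (∀ (L : Type u) [AddCommGroup L] [Module R L],
      ∀ x ∈ LinearMap.ker (LinearMap.lTensor L (evalMap R M Ehat)),
        IsGVTorsionElem R x) := by
  have mem_of_forall {N : Type u} [AddCommGroup N] [Module R N] {x : N}
      (h : ∀ f : N →ₗ[R] Ehat, f x = 0) : IsGVTorsionElem R x := by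
    by_contra hx
    obtain ⟨f, hf⟩ := hE.exists_apply_ne_zero hx
    exact hf (h f)
  refine ⟨fun x hx => mem_of_forall fun f => LinearMap.congr_fun hx f,
    fun L _ _ x hx => mem_of_forall fun f => ?_⟩
  let F : L ⊗[R] ((M →ₗ[R] Ehat) →ₗ[R] Ehat) →ₗ[R] Ehat :=
    TensorProduct.lift ((evalMap R (M →ₗ[R] Ehat) Ehat).comp (TensorProduct.curry f))
  have hF : F.comp (LinearMap.lTensor L (evalMap R M Ehat)) = f :=
    TensorProduct.ext' fun l m => rfl
  rw [← hF, LinearMap.comp_apply, LinearMap.mem_ker.mp hx, map_zero]
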